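/- arXiv:math/0302223 — 3 statements merged into one kernel-verified Lean document; each statement's English description precedes it below -/
import Mathlib

section
/- An integral domain R is seminormal if and only if every nonzero strongly divisorial ideal I of R is a radical ideal of the ring (I : I), that is, for every t ∈ (I : I) with t² ∈ I one has t ∈ I. -/
/-! Basic notions: for an integral domain `R` with fraction field `K`, an ideal `I`
is viewed as the submodule `idealToFrac R I` of `K`; `1 / M` is the Mathlib
submodule quotient `(R : M) = {x ∈ K | x M ⊆ R}` and `M / N = {x ∈ K | x N ⊆ M}`. -/

variable (R : Type*) [CommRing R] [IsDomain R]

/-- The image of an ideal of `R` in the fraction field, as an `R`-submodule. -/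
def idealToFrac (I : Ideal R) : Submodule R (FractionRing R) :=
  Submodule.map (Algebra.linearMap R (FractionRing R)) I

/-- An ideal `I` is strong if `(R : I) = (I : I)`. -/
def IsStrong (I : Ideal R) : Prop :=
  1 / idealToFrac R I = idealToFrac R I / idealToFrac R I

/-- An ideal `I` is divisorial if `(R : (R : I)) = I`. -/
def IsDivisorial (I : Ideal R) : Prop :=
  1 / (1 / idealToFrac R I) = idealToFrac R I

/-- `R` is seminormal if every `x ∈ K` with `x², x³ ∈ R` lies in `R`. -/
def Seminormal : Prop :=
  ∀ x : FractionRing R,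
    x ^ 2 ∈ (algebraMap R (FractionRing R)).range →
    x ^ 3 ∈ (algebraMap R (FractionRing R)).range →
    x ∈ (algebraMap R (FractionRing R)).range

/-- `R` is completely integrally closed if every almost integral element of `K` lies in `R`. -/
def CompletelyIntegrallyClosed : Prop :=
  ∀ x : FractionRing R,
    (∃ d : R, d ≠ 0 ∧
      ∀ n : ℕ, algebraMap R (FractionRing R) d * x ^ n ∈ (algebraMap R (FractionRing R)).range) →
    x ∈ (algebraMap R (FractionRing R)).range

/-- The `v`-operation `M ↦ (R : (R : M))` on submodules of the fraction field. -/
def vOp (M : Submodule R (FractionRing R)) : Submodule R (FractionRing R) :=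
  1 / (1 / M)

/-- The `t`-closure `M_t = ⋃ J_v`, the union over finitely generated `J ⊆ M`. -/
def tClosure (M : Submodule R (FractionRing R)) : Submodule R (FractionRing R) :=
  ⨆ (J : Submodule R (FractionRing R)) (_ : J.FG) (_ : J ≤ M), vOp R J

/-- An ideal `I` is a `t`-ideal if `I_t = I`. -/
def IsTIdeal (I : Ideal R) : Prop :=
  tClosure R (idealToFrac R I) = idealToFrac R I

/-- A maximal `t`-ideal is an ideal maximal among the proper integral `t`-ideals. -/
def IsMaximalTIdeal (I : Ideal R) : Prop :=
  I ≠ ⊤ ∧ IsTIdeal R I ∧ ∀ J : Ideal R, J ≠ ⊤ → IsTIdeal R J → I ≤ J → J = I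

/-- An ideal `I` is `t`-invertible if `(I (R : I))_t = R`. -/
def IsTInvertible (I : Ideal R) : Prop :=
  tClosure R (idealToFrac R I * (1 / idealToFrac R I)) = 1

/-- An ideal `I` is invertible if `I (R : I) = R`. -/
def IsInvertibleIdeal (I : Ideal R) : Prop :=
  idealToFrac R I * (1 / idealToFrac R I) = 1

/-- Membership in `idealToFrac`. -/
lemma mem_idealToFrac_iff {R : Type*} [CommRing R] [IsDomain R] (I : Ideal R)
    (x : FractionRing R) :
    x ∈ idealToFrac R I ↔ ∃ r ∈ I, algebraMap R (FractionRing R) r = x := by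
  simp [idealToFrac]

/-- The conductor ideal `{r | r x ∈ R}`. -/
def conductorIdeal {R : Type*} [CommRing R] [IsDomain R] (x : FractionRing R) : Ideal R where
  carrier := {r | algebraMap R (FractionRing R) r * x ∈ (algebraMap R (FractionRing R)).range}
  add_mem' := by
    intro a b ha hb
    simp only [Set.mem_setOf_eq, map_add, add_mul] at *
    exact add_mem ha hb
  zero_mem' := by simp
  smul_mem' := by
    intro c a ha
    simp only [Set.mem_setOf_eq, smul_eq_mul, map_mul, mul_assoc] at *
    exact mul_mem ⟨c, rfl⟩ ha

lemma mem_idealToFrac_conductor {R : Type*} [CommRing R] [IsDomain R] (x y : FractionRing R) :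
    y ∈ idealToFrac R (conductorIdeal x) ↔
      y ∈ (algebraMap R (FractionRing R)).range ∧
        y * x ∈ (algebraMap R (FractionRing R)).range := by
  rw [mem_idealToFrac_iff]
  constructor
  · rintro ⟨r, hr, rfl⟩
    exact ⟨⟨r, rfl⟩, hr⟩
  · rintro ⟨⟨r, rfl⟩, h⟩
    exact ⟨r, h, rfl⟩

lemma mem_one_iff_range {R : Type*} [CommRing R] [IsDomain R] (y : FractionRing R) :
    y ∈ (1 : Submodule R (FractionRing R)) ↔ y ∈ (algebraMap R (FractionRing R)).range := by
  rw [Submodule.mem_one, RingHom.mem_range]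

/-- A domain `R` is seminormal if and only if every nonzero strongly divisorial ideal
`I` of `R` is a radical ideal of the overring `(I : I)`, that is, every `t ∈ (I : I)`
with `t² ∈ I` lies in `I`. -/
theorem seminormal_iff_strongly_divisorial_radical {R : Type*} [CommRing R] [IsDomain R] :
    Seminormal R ↔
      ∀ I : Ideal R, I ≠ ⊥ → IsStrong R I → IsDivisorial R I →
        ∀ t ∈ idealToFrac R I / idealToFrac R I,
          t ^ 2 ∈ idealToFrac R I → t ∈ idealToFrac R I := by
  constructor
  · intro hR I _ hS hD t ht ht2
    have hIR : ∀ y ∈ idealToFrac R I, y ∈ (algebraMap R (FractionRing R)).range := by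
      intro y hy
      obtain ⟨r, _, rfl⟩ := (mem_idealToFrac_iff I y).1 hy
      exact ⟨r, rfl⟩
    rw [← hD, Submodule.mem_div_iff_forall_mul_mem]
    intro s hs
    rw [hS] at hs
    rw [Submodule.mem_div_iff_forall_mul_mem] at hs ht
    rw [mem_one_iff_range]
    have h2 : (t * s) ^ 2 ∈ idealToFrac R I := by
      have h := hs _ (hs _ ht2)
      convert h using 1
      ring
    have h3 : (t * s) ^ 3 ∈ idealToFrac R I := by
      have h := ht _ (hs _ h2)
      convert h using 1
      ring
    exact hR _ (hIR _ h2) (hIR _ h3)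
  · intro H x hx2 hx3
    have hmem := mem_idealToFrac_conductor x
    have hxI : ∀ y ∈ idealToFrac R (conductorIdeal x),
        x * y ∈ idealToFrac R (conductorIdeal x) := by
      intro y hy
      rw [hmem] at hy ⊢
      refine ⟨by rw [mul_comm]; exact hy.2, ?_⟩
      have h := mul_mem hy.1 hx2
      convert h using 1
      ring
    have hne : conductorIdeal x ≠ ⊥ := by
      obtain ⟨a, b, hb, rfl⟩ := IsFractionRing.div_surjective (A := R) x
      have hb0 : b ≠ 0 := nonZeroDivisors.ne_zero hb
      have hb' : algebraMap R (FractionRing R) b ≠ 0 := by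
        simpa using hb0
      intro h
      apply hb0
      rw [← Ideal.mem_bot, ← h]
      exact ⟨a, by field_simp⟩
    have hsub : idealToFrac R (conductorIdeal x) ≤ 1 := by
      intro y hy
      rw [mem_one_iff_range]
      exact ((hmem y).1 hy).1
    have hS : IsStrong R (conductorIdeal x) := by
      apply le_antisymm
      · intro y hy
        rw [Submodule.mem_div_iff_forall_mul_mem] at hy ⊢
        intro z hz
        rw [hmem, ← mem_one_iff_range, ← mem_one_iff_range]
        refine ⟨hy z hz, ?_⟩
        have h := hy _ (hxI z hz)
        convert h using 1
        ring
      · intro y hy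
        rw [Submodule.mem_div_iff_forall_mul_mem] at hy ⊢
        exact fun z hz => hsub (hy z hz)
    have hD : IsDivisorial R (conductorIdeal x) := by
      apply le_antisymm
      · intro y hy
        rw [Submodule.mem_div_iff_forall_mul_mem] at hy
        rw [hmem, ← mem_one_iff_range, ← mem_one_iff_range]
        refine ⟨?_, ?_⟩
        · have h := hy 1 (by
            rw [Submodule.mem_div_iff_forall_mul_mem]
            intro z hz
            rw [one_mul]
            exact hsub hz)
          rwa [mul_one] at h
        · apply hy
          rw [Submodule.mem_div_iff_forall_mul_mem]
          exact fun z hz => hsub (hxI z hz)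
      · intro y hy
        rw [Submodule.mem_div_iff_forall_mul_mem]
        intro z hz
        rw [Submodule.mem_div_iff_forall_mul_mem] at hz
        rw [mul_comm]
        exact hz y hy
    have hx : x ∈ idealToFrac R (conductorIdeal x) := by
      refine H _ hne hS hD x ?_ ?_
      · rw [Submodule.mem_div_iff_forall_mul_mem]
        exact hxI
      · rw [hmem]
        exact ⟨hx2, by rw [← pow_succ]; exact hx3⟩
    exact ((hmem x).1 hx).1
end

section
/- Let R be a TV-domain, that is, an integral domain in which every t-ideal is divisorial. Then R has no strongly divisorial prime ideals if and only if R is completely integrally closed. -/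
/-! Basic notions: for an integral domain `R` with fraction field `K`, an ideal `I`
is viewed as the submodule `idealToFrac R I` of `K`; `1 / M` is the Mathlib
submodule quotient `(R : M) = {x ∈ K | x M ⊆ R}` and `M / N = {x ∈ K | x N ⊆ M}`. -/

variable (R : Type*) [CommRing R] [IsDomain R]

section Helpers

variable {R : Type*} [CommRing R] [IsDomain R]

lemma mem_F {I : Ideal R} {x : FractionRing R} :
    x ∈ idealToFrac R I ↔ ∃ r ∈ I, algebraMap R (FractionRing R) r = x := by
  simp [idealToFrac]

lemma algebraMap_mem_F {I : Ideal R} {r : R} :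
    algebraMap R (FractionRing R) r ∈ idealToFrac R I ↔ r ∈ I := by
  rw [mem_F]
  constructor
  · rintro ⟨s, hs, h⟩
    rwa [← IsFractionRing.injective R (FractionRing R) h]
  · intro h; exact ⟨r, h, rfl⟩

lemma F_mono {I J : Ideal R} (h : I ≤ J) : idealToFrac R I ≤ idealToFrac R J :=
  Submodule.map_mono h

lemma F_le_one (I : Ideal R) : idealToFrac R I ≤ 1 := by
  intro x hx
  obtain ⟨r, _, rfl⟩ := mem_F.1 hx
  exact Submodule.mem_one.2 ⟨r, rfl⟩

lemma mem_inv {M : Submodule R (FractionRing R)} {x : FractionRing R} :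
    x ∈ 1 / M ↔ ∀ y ∈ M, x * y ∈ (1 : Submodule R (FractionRing R)) :=
  Submodule.mem_div_iff_forall_mul_mem

lemma le_v (M : Submodule R (FractionRing R)) : M ≤ 1 / (1 / M) := by
  intro x hx
  rw [mem_inv]
  intro y hy
  rw [mul_comm]
  exact mem_inv.1 hy x hx

lemma inv_anti {M N : Submodule R (FractionRing R)} (h : M ≤ N) : 1 / N ≤ 1 / M := by
  intro x hx
  rw [mem_inv] at *
  exact fun y hy => hx y (h hy)

/-- Strongness, elementwise. -/
lemma isStrong_iff {I : Ideal R} : IsStrong R I ↔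
    ∀ x ∈ 1 / idealToFrac R I, ∀ y ∈ idealToFrac R I, x * y ∈ idealToFrac R I := by
  unfold IsStrong
  constructor
  · intro h x hx
    rw [h] at hx
    exact Submodule.mem_div_iff_forall_mul_mem.1 hx
  · intro h
    apply le_antisymm
    · intro x hx
      exact Submodule.mem_div_iff_forall_mul_mem.2 (h x hx)
    · intro x hx
      rw [mem_inv]
      intro y hy
      exact F_le_one _ (Submodule.mem_div_iff_forall_mul_mem.1 hx y hy)

lemma isDivisorial_of {I : Ideal R}
    (h : ∀ x : FractionRing R,
      x ∈ 1 / (1 / idealToFrac R I) → x ∈ idealToFrac R I) : IsDivisorial R I :=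
  le_antisymm h (le_v _)

lemma v_le_one (I : Ideal R) : 1 / (1 / idealToFrac R I) ≤ 1 := by
  intro x hx
  have := mem_inv.1 hx 1 (mem_inv.2 fun y hy => by rw [one_mul]; exact F_le_one _ hy)
  rwa [mul_one] at this

/-- Backward direction. -/
lemma no_sd_of_cic (h : CompletelyIntegrallyClosed R) (P : Ideal R) (hP : P.IsPrime)
    (h0 : P ≠ ⊥) (hs : IsStrong R P) (hd : IsDivisorial R P) : False := by
  obtain ⟨d, hdP, hd0⟩ := Submodule.exists_mem_ne_zero_of_ne_bot h0
  have hs' := isStrong_iff.1 hs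
  apply hP.ne_top
  rw [Ideal.eq_top_iff_one, ← algebraMap_mem_F, map_one]
  have hd' : 1 / (1 / idealToFrac R P) = idealToFrac R P := hd
  rw [← hd', mem_inv]
  intro x hx
  rw [one_mul]
  have key : ∀ n : ℕ, algebraMap R (FractionRing R) d * x ^ n ∈ idealToFrac R P := by
    intro n
    induction n with
    | zero => simpa using algebraMap_mem_F.2 hdP
    | succ n ih =>
      have := hs' x hx _ ih
      rw [pow_succ]
      convert this using 1
      ring
  obtain ⟨r, hr⟩ := h x ⟨d, hd0, fun n => by
    obtain ⟨r, _, hr⟩ := mem_F.1 (key n)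
    exact ⟨r, hr⟩⟩
  exact Submodule.mem_one.2 ⟨r, hr⟩

/-- The conductor of `R[x]` is strongly divisorial. -/
lemma exists_sd {x : FractionRing R} (hx : x ∉ (algebraMap R (FractionRing R)).range)
    {d : R} (hd0 : d ≠ 0)
    (hd : ∀ n : ℕ, algebraMap R (FractionRing R) d * x ^ n ∈
      (algebraMap R (FractionRing R)).range) :
    ∃ I : Ideal R, I ≠ ⊥ ∧ I ≠ ⊤ ∧ IsStrong R I ∧ IsDivisorial R I := by
  let I : Ideal R :=
    { carrier := {r | ∀ n : ℕ, algebraMap R (FractionRing R) r * x ^ n ∈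
        (1 : Submodule R (FractionRing R))}
      add_mem' := by
        intro a b ha hb n
        rw [map_add, add_mul]
        exact add_mem (ha n) (hb n)
      zero_mem' := by
        intro n
        simp
      smul_mem' := by
        intro c a ha n
        have := Submodule.smul_mem _ c (ha n)
        rw [Algebra.smul_def] at this
        rwa [smul_eq_mul, map_mul, mul_assoc] }
  have hmem : ∀ r : R, r ∈ I ↔ ∀ n : ℕ, algebraMap R (FractionRing R) r * x ^ n ∈
        (1 : Submodule R (FractionRing R)) := fun r => Iff.rfl
  have hF : ∀ y : FractionRing R, (∀ n : ℕ, y * x ^ n ∈ (1 : Submodule R (FractionRing R))) →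
      y ∈ idealToFrac R I := by
    intro y hy
    obtain ⟨r, rfl⟩ := Submodule.mem_one.1 (by simpa using hy 0)
    exact algebraMap_mem_F.2 hy
  have hF' : ∀ y ∈ idealToFrac R I, ∀ n : ℕ, y * x ^ n ∈ idealToFrac R I := by
    intro y hy n
    obtain ⟨r, hr, rfl⟩ := mem_F.1 hy
    apply hF
    intro m
    rw [mul_assoc, ← pow_add]
    exact hr _
  refine ⟨I, ?_, ?_, ?_, ?_⟩
  · intro h
    apply hd0
    have : d ∈ I := fun n => by
      obtain ⟨r, hr⟩ := hd n
      exact Submodule.mem_one.2 ⟨r, hr⟩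
    rw [h] at this
    exact this
  · intro h
    apply hx
    have : (1 : R) ∈ I := by rw [h]; trivial
    obtain ⟨r, hr⟩ := Submodule.mem_one.1 (this 1)
    exact ⟨r, by simpa using hr⟩
  · rw [isStrong_iff]
    intro z hz y hy
    apply hF
    intro n
    rw [mul_assoc]
    exact mem_inv.1 hz _ (hF' y hy n)
  · apply isDivisorial_of
    intro y hy
    apply hF
    intro n
    apply mem_inv.1 hy
    rw [mem_inv]
    intro z hz
    rw [mul_comm]
    exact F_le_one _ (hF' z hz n)

/-- A colon ideal of a strongly divisorial ideal is strongly divisorial. -/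
lemma sd_colon {P : Ideal R} (hs : IsStrong R P) (hd : IsDivisorial R P) (a : R)
    {Q : Ideal R} (hQ : ∀ r, r ∈ Q ↔ r * a ∈ P) : IsStrong R Q ∧ IsDivisorial R Q := by
  have hd' : 1 / (1 / idealToFrac R P) = idealToFrac R P := hd
  have hs' := isStrong_iff.1 hs
  have hPQ : P ≤ Q := fun r hr => (hQ r).2 (P.mul_mem_right a hr)
  have hQF : ∀ y ∈ (1 : Submodule R (FractionRing R)),
      y * algebraMap R (FractionRing R) a ∈ idealToFrac R P → y ∈ idealToFrac R Q := by
    intro y hy h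
    obtain ⟨r, rfl⟩ := Submodule.mem_one.1 hy
    rw [← map_mul, algebraMap_mem_F] at h
    exact algebraMap_mem_F.2 ((hQ r).2 h)
  have hQF' : ∀ y ∈ idealToFrac R Q,
      y * algebraMap R (FractionRing R) a ∈ idealToFrac R P := by
    intro y hy
    obtain ⟨r, hr, rfl⟩ := mem_F.1 hy
    rw [← map_mul, algebraMap_mem_F]
    exact (hQ r).1 hr
  constructor
  · rw [isStrong_iff]
    intro x hx q hq
    apply hQF _ (mem_inv.1 hx q hq)
    rw [← hd', mem_inv]
    intro t ht
    have h1 := hs' t ht _ (hQF' q hq)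
    have h2 := mem_inv.1 hx _ (F_mono hPQ h1)
    convert h2 using 1
    ring
  · apply isDivisorial_of
    intro y hy
    apply hQF _ (v_le_one _ hy)
    rw [← hd', mem_inv]
    intro t ht
    rw [mul_assoc]
    apply mem_inv.1 hy
    rw [mem_inv]
    intro q hq
    have h1 := F_le_one _ (hs' t ht _ (hQF' q hq))
    convert h1 using 1
    ring

/-- The union of a chain of divisorial ideals is a t-ideal. -/
lemma isTIdeal_sSup {c : Set (Ideal R)} (hc : IsChain (· ≤ ·) c) (hne : c.Nonempty)
    (hd : ∀ I ∈ c, IsDivisorial R I) : IsTIdeal R (sSup c) := by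
  unfold IsTIdeal tClosure
  apply le_antisymm
  · refine iSup_le fun J => iSup_le fun hJ => iSup_le fun hle => ?_
    obtain ⟨s, rfl⟩ := hJ
    have key : ∀ s : Finset (FractionRing R), (∀ x ∈ s, x ∈ idealToFrac R (sSup c)) →
        ∃ I ∈ c, ∀ x ∈ s, x ∈ idealToFrac R I := by
      classical
      intro s
      induction s using Finset.induction_on with
      | empty =>
        intro _
        obtain ⟨I, hI⟩ := hne
        exact ⟨I, hI, by simp⟩
      | insert a s _ ih =>
        intro h
        obtain ⟨I, hI, hIs⟩ := ih fun x hx => h x (Finset.mem_insert_of_mem hx)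
        obtain ⟨r, hr, hra⟩ := mem_F.1 (h a (Finset.mem_insert_self _ _))
        obtain ⟨I', hI', hrI'⟩ := (Submodule.mem_sSup_of_directed hne hc.directedOn).1 hr
        have ha : a ∈ idealToFrac R I' := mem_F.2 ⟨r, hrI', hra⟩
        rcases hc.total hI hI' with h1 | h1
        · refine ⟨I', hI', fun x hx => ?_⟩
          rcases Finset.mem_insert.1 hx with rfl | hx
          · exact ha
          · exact F_mono h1 (hIs x hx)
        · refine ⟨I, hI, fun x hx => ?_⟩
          rcases Finset.mem_insert.1 hx with rfl | hx
          · exact F_mono h1 ha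
          · exact hIs x hx
    obtain ⟨I, hI, hIs⟩ := key s fun x hx => hle (Submodule.subset_span hx)
    have h1 : Submodule.span R (s : Set (FractionRing R)) ≤ idealToFrac R I :=
      Submodule.span_le.2 hIs
    have h2 : 1 / (1 / idealToFrac R I) = idealToFrac R I := hd I hI
    have h3 : vOp R (Submodule.span R (s : Set (FractionRing R))) ≤ idealToFrac R I := by
      rw [← h2]
      exact inv_anti (inv_anti h1)
    exact h3.trans (F_mono (le_sSup hI))
  · intro x hx
    have h1 : Submodule.span R {x} ≤ idealToFrac R (sSup c) := by
      rw [Submodule.span_le]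
      simpa using hx
    have h2 : vOp R (Submodule.span R {x}) ≤ ⨆ (J : Submodule R (FractionRing R)) (_ : J.FG)
        (_ : J ≤ idealToFrac R (sSup c)), vOp R J :=
      le_iSup_of_le _ (le_iSup_of_le (Submodule.fg_span_singleton x) (le_iSup_of_le h1 le_rfl))
    exact h2 (le_v _ (Submodule.mem_span_singleton_self x))

lemma isStrong_sSup {c : Set (Ideal R)} (hc : IsChain (· ≤ ·) c) (hne : c.Nonempty)
    (hs : ∀ I ∈ c, IsStrong R I) : IsStrong R (sSup c) := by
  rw [isStrong_iff]
  intro x hx y hy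
  obtain ⟨r, hr, rfl⟩ := mem_F.1 hy
  obtain ⟨I, hI, hrI⟩ := (Submodule.mem_sSup_of_directed hne hc.directedOn).1 hr
  have hle := F_mono (le_sSup hI)
  exact hle (isStrong_iff.1 (hs I hI) x (inv_anti hle hx) _ (algebraMap_mem_F.2 hrI))

end Helpers

/-- Let `R` be a TV-domain (every nonzero `t`-ideal is divisorial). Then `R` has no
strongly divisorial prime ideals if and only if `R` is completely integrally closed. -/
theorem tv_domain_no_sd_prime_iff_cic {R : Type*} [CommRing R] [IsDomain R]
    (hTV : ∀ I : Ideal R, I ≠ ⊥ → IsTIdeal R I → IsDivisorial R I) :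
    (¬ ∃ P : Ideal R, P.IsPrime ∧ P ≠ ⊥ ∧ IsStrong R P ∧ IsDivisorial R P) ↔
      CompletelyIntegrallyClosed R := by
  constructor
  · intro hno x ⟨d, hd0, hd⟩
    by_contra hx
    obtain ⟨I, hI0, hI1, hIs, hId⟩ := exists_sd hx hd0 hd
    let S : Set (Ideal R) := {I | I ≠ ⊥ ∧ I ≠ ⊤ ∧ IsStrong R I ∧ IsDivisorial R I}
    obtain ⟨P, -, hP⟩ := zorn_le_nonempty₀ S (by
      intro c hcS hc J hJ
      have hne : c.Nonempty := ⟨J, hJ⟩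
      have hb : sSup c ≠ ⊥ := fun h => (hcS hJ).1 (le_bot_iff.1 (h ▸ le_sSup hJ))
      refine ⟨sSup c, ⟨hb, ?_, isStrong_sSup hc hne fun I hI => (hcS hI).2.2.1,
        hTV _ hb (isTIdeal_sSup hc hne fun I hI => (hcS hI).2.2.2)⟩, fun z hz => le_sSup hz⟩
      intro h
      have h1 : (1 : R) ∈ sSup c := by rw [h]; trivial
      obtain ⟨I, hI, h1I⟩ := (Submodule.mem_sSup_of_directed hne hc.directedOn).1 h1
      exact (hcS hI).2.1 ((Ideal.eq_top_iff_one I).2 h1I)) I ⟨hI0, hI1, hIs, hId⟩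
    obtain ⟨hP0, hP1, hPs, hPd⟩ := hP.prop
    refine hno ⟨P, ⟨hP1, ?_⟩, hP0, hPs, hPd⟩
    intro a b hab
    by_contra! hcon
    obtain ⟨ha, hb⟩ := hcon
    let Q : Ideal R := Submodule.comap (LinearMap.mulRight R a) P
    have hQ : ∀ r, r ∈ Q ↔ r * a ∈ P := fun r => by simp [Q]
    obtain ⟨hQs, hQd⟩ := sd_colon hPs hPd a hQ
    have hPQ : P ≤ Q := fun r hr => (hQ r).2 (P.mul_mem_right a hr)
    have hQS : Q ∈ S := by
      refine ⟨fun h => hP0 (le_bot_iff.1 (h ▸ hPQ)), fun h => ha ?_, hQs, hQd⟩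
      have : (1 : R) ∈ Q := by rw [h]; trivial
      simpa using (hQ 1).1 this
    exact hb (hP.le_of_ge hQS hPQ ((hQ b).2 (by rwa [mul_comm])))
  · rintro h ⟨P, hP, h0, hs, hd⟩
    exact no_sd_of_cic h P hP h0 hs hd
end

section
/- Let R be a one-dimensional integral domain (Krull dimension 1) that is not completely integrally closed and such that the intersection of all maximal ideals of R is an irredundant intersection. If R is seminormal, or more generally if every nonzero strong ideal of R is a radical ideal (i.e., R is an RTP-domain), then R has a strongly divisorial maximal ideal. -/
/-! Basic notions: for an integral domain `R` with fraction field `K`, an ideal `I`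
is viewed as the submodule `idealToFrac R I` of `K`; `1 / M` is the Mathlib
submodule quotient `(R : M) = {x ∈ K | x M ⊆ R}` and `M / N = {x ∈ K | x N ⊆ M}`. -/

variable (R : Type*) [CommRing R] [IsDomain R]

theorem sdm_strong_div (R : Type*) [CommRing R] [IsDomain R]
    (hncic : ¬ CompletelyIntegrallyClosed R) :
    ∃ I : Ideal R, I ≠ ⊥ ∧ I ≠ ⊤ ∧ IsStrong R I ∧ IsDivisorial R I := by
  unfold CompletelyIntegrallyClosed at hncic
  push Not at hncic
  obtain ⟨x, ⟨d, hd0, hd⟩, hx⟩ := hncic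
  have h1 : ∀ y : FractionRing R, y ∈ (1 : Submodule R (FractionRing R)) ↔
      y ∈ (algebraMap R (FractionRing R)).range := by
    intro y
    simp [Submodule.mem_one]
  let C : Submodule R (FractionRing R) :=
    { carrier := {c | ∀ n : ℕ, c * x ^ n ∈ (1 : Submodule R (FractionRing R))}
      add_mem' := by
        intro a b ha hb n
        rw [add_mul]
        exact add_mem (ha n) (hb n)
      zero_mem' := by
        intro n
        rw [zero_mul]
        exact zero_mem _
      smul_mem' := by
        intro r a ha n
        rw [smul_mul_assoc]
        exact Submodule.smul_mem _ _ (ha n) }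
  have hC : ∀ c, c ∈ C ↔ ∀ n : ℕ, c * x ^ n ∈ (1 : Submodule R (FractionRing R)) :=
    fun c => Iff.rfl
  let D := (1 : Submodule R (FractionRing R)) / C
  let W := D / D
  have hD : ∀ e, e ∈ D ↔ ∀ c ∈ C, e * c ∈ (1 : Submodule R (FractionRing R)) :=
    fun e => Submodule.mem_div_iff_forall_mul_mem
  have hW : ∀ e, e ∈ W ↔ ∀ c ∈ D, e * c ∈ D :=
    fun e => Submodule.mem_div_iff_forall_mul_mem
  have hJ : ∀ e, e ∈ 1 / W ↔ ∀ c ∈ W, e * c ∈ (1 : Submodule R (FractionRing R)) :=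
    fun e => Submodule.mem_div_iff_forall_mul_mem
  have hW1 : (1 : FractionRing R) ∈ W := by
    rw [hW]; intro c hc; simpa using hc
  have hWW : ∀ a ∈ W, ∀ b ∈ W, a * b ∈ W := by
    intro a ha b hb
    rw [hW] at *
    intro c hc
    rw [mul_assoc]
    exact ha _ (hb _ hc)
  have hxW : x ∈ W := by
    rw [hW]; intro e he
    rw [hD] at *
    intro c hc
    have := he (x * c) (by
      rw [hC] at *
      intro n
      have := hc (n + 1)
      rwa [show x * c * x ^ n = c * x ^ (n + 1) by ring])
    rwa [show x * e * c = e * (x * c) by ring]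
  have hD1 : (1 : FractionRing R) ∈ D := by
    rw [hD]; intro c hc
    simpa using hc 0
  have hDC : ∀ e ∈ D, ∀ c ∈ C, e * c ∈ 1 / W := by
    intro e he c hc
    rw [hJ]; intro w hw
    have := (hD _).1 ((hW w).1 hw e he) c hc
    rwa [show e * c * w = w * e * c by ring]
  have hJ1 : 1 / W ≤ 1 := by
    intro y hy
    simpa using (hJ y).1 hy 1 hW1
  let I : Ideal R := Submodule.comap (Algebra.linearMap R (FractionRing R)) (1 / W)
  have hI : idealToFrac R I = 1 / W := by
    unfold idealToFrac
    rw [Submodule.map_comap_eq]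
    apply inf_eq_right.2
    rw [← Submodule.one_eq_range]
    exact hJ1
  have hRI : 1 / idealToFrac R I = W := by
    rw [hI]
    apply le_antisymm
    · intro y hy
      rw [Submodule.mem_div_iff_forall_mul_mem] at hy
      rw [hW]
      intro e he
      rw [hD]
      intro c hc
      rw [mul_assoc]
      exact hy _ (hDC e he c hc)
    · intro y hy
      rw [Submodule.mem_div_iff_forall_mul_mem]
      intro c hc
      rw [mul_comm]
      exact (hJ c).1 hc y hy
  refine ⟨I, ?_, ?_, ?_, ?_⟩
  · intro h
    have : d ∈ I := by
      change algebraMap R (FractionRing R) d ∈ 1 / W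
      have := hDC 1 hD1 (algebraMap R (FractionRing R) d) (fun n => (h1 _).2 (hd n))
      simpa using this
    rw [h] at this
    exact hd0 (by simpa using this)
  · intro h
    have h2 : (1 : R) ∈ I := by rw [h]; trivial
    have h3 : algebraMap R (FractionRing R) 1 ∈ 1 / W := h2
    have := (hJ _).1 h3 x hxW
    rw [map_one, one_mul, h1] at this
    exact hx this
  · unfold IsStrong
    rw [hRI, hI]
    apply le_antisymm
    · intro w hw
      rw [Submodule.mem_div_iff_forall_mul_mem]
      intro y hy
      rw [hJ] at *
      intro v hv
      have := hy _ (hWW w hw v hv)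
      rwa [show w * y * v = y * (w * v) by ring]
    · conv_rhs => rw [← hRI, hI]
      intro w hw
      rw [Submodule.mem_div_iff_forall_mul_mem] at *
      exact fun y hy => hJ1 (hw y hy)
  · unfold IsDivisorial
    rw [hRI, hI]

theorem sdm_mem_iff {R : Type*} [CommRing R] [IsDomain R] (I : Ideal R) (r : R) :
    algebraMap R (FractionRing R) r ∈ idealToFrac R I ↔ r ∈ I := by
  unfold idealToFrac
  rw [Submodule.mem_map]
  constructor
  · rintro ⟨y, hy, h⟩
    rwa [← IsFractionRing.injective R (FractionRing R) h]
  · exact fun h => ⟨r, h, rfl⟩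

theorem sdm_radical {R : Type*} [CommRing R] [IsDomain R] (I : Ideal R) (hs : IsStrong R I)
    (hd : IsDivisorial R I) (h : Seminormal R) : I.IsRadical := by
  have key : ∀ r : R, r ^ 2 ∈ I → r ∈ I := by
    intro r hr
    rw [← sdm_mem_iff, ← show _ = _ from hd, Submodule.mem_div_iff_forall_mul_mem]
    intro t ht
    rw [show _ = _ from hs, Submodule.mem_div_iff_forall_mul_mem] at ht
    have hr' := (sdm_mem_iff I _).2 hr
    rw [map_pow] at hr'
    have a2 := ht _ (ht _ hr')
    have a3 := Submodule.smul_mem _ r (ht _ a2)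
    have hle : ∀ y ∈ idealToFrac R I, y ∈ (algebraMap R (FractionRing R)).range := by
      rintro y ⟨z, -, rfl⟩
      exact ⟨z, rfl⟩
    have := h (algebraMap R (FractionRing R) r * t)
      (by convert hle _ a2 using 1; ring)
      (by convert hle _ a3 using 1; rw [Algebra.smul_def]; ring)
    simpa [Submodule.mem_one] using this
  have key2 : ∀ n : ℕ, ∀ r : R, r ^ (2 ^ n) ∈ I → r ∈ I := by
    intro n
    induction n with
    | zero => intro r hr; simpa using hr
    | succ n ih =>
      intro r hr
      rw [pow_succ, pow_mul] at hr
      exact ih r (key _ hr)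
  rintro r ⟨n, hn⟩
  exact key2 n r (Ideal.pow_mem_of_pow_mem I hn Nat.lt_two_pow_self.le)

/-- Let `R` be a one-dimensional domain that is not completely integrally closed and
such that the intersection of the maximal ideals is irredundant. If `R` is seminormal,
or more generally every nonzero strong ideal of `R` is radical (`R` is an RTP-domain),
then `R` has a strongly divisorial maximal ideal. -/
theorem exists_strongly_divisorial_maximal {R : Type*} [CommRing R] [IsDomain R]
    (hdim : ringKrullDim R = 1)
    (hncic : ¬ CompletelyIntegrallyClosed R)
    (hirr : ∀ M : Ideal R, M.IsMaximal →
      ¬ (⨅ (N : Ideal R) (_ : N.IsMaximal) (_ : N ≠ M), N) ≤ M)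
    (hsn : Seminormal R ∨ ∀ I : Ideal R, I ≠ ⊥ → IsStrong R I → I.IsRadical) :
    ∃ M : Ideal R, M.IsMaximal ∧ M ≠ ⊥ ∧ IsStrong R M ∧ IsDivisorial R M := by
  obtain ⟨I, hI0, hIT, hs, hd⟩ := sdm_strong_div R hncic
  have hrad : I.IsRadical := by
    rcases hsn with h | h
    · exact sdm_radical I hs hd h
    · exact h I hI0 hs
  obtain ⟨M, hM, hIM⟩ := Ideal.exists_le_maximal I hIT
  have hdim1 : Ring.KrullDimLE 1 R := (Ring.krullDimLE_iff).2 (by rw [hdim]; rfl)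
  obtain ⟨a, ha, haM⟩ := SetLike.not_le_iff_exists.1 (hirr M hM)
  have haI : ∀ r ∈ M, a * r ∈ I := by
    intro r hr
    rw [← hrad.radical, Ideal.radical_eq_sInf, Ideal.mem_sInf]
    rintro N ⟨hIN, hN⟩
    have hNm : N.IsMaximal := hN.isMaximal_of_ne_bot (fun h => hI0 (le_bot_iff.1 (h ▸ hIN)))
    by_cases hNM : N = M
    · rw [hNM]; exact M.mul_mem_left _ hr
    · refine N.mul_mem_right _ ?_
      simp only [Submodule.mem_iInf] at ha
      exact ha N hNm hNM
  have hprime : ∀ r, a * r ∈ M → r ∈ M := fun r hr =>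
    (hM.isPrime.mem_or_mem hr).resolve_left haM
  have hle1 : ∀ J : Ideal R, idealToFrac R J ≤ 1 := by
    rintro J y ⟨z, -, rfl⟩
    exact Submodule.mem_one.2 ⟨z, rfl⟩
  refine ⟨M, hM, fun h => hI0 (le_bot_iff.1 (h ▸ hIM)), ?_, ?_⟩
  · apply le_antisymm
    · intro y hy
      have hyI : y ∈ idealToFrac R I / idealToFrac R I := by
        rw [← show _ = _ from hs]
        rw [Submodule.mem_div_iff_forall_mul_mem] at *
        intro z hz
        exact hy z (Submodule.map_mono hIM hz)
      rw [Submodule.mem_div_iff_forall_mul_mem] at *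
      rintro _ ⟨m, hm, rfl⟩
      have h2 := hy _ ⟨m, hm, rfl⟩
      obtain ⟨r, hr⟩ := Submodule.mem_one.1 h2
      have h3 := hyI _ ((sdm_mem_iff I _).2 (haI m hm))
      rw [← hr, sdm_mem_iff]
      apply hprime
      apply hIM
      rw [← sdm_mem_iff, map_mul, hr]
      convert h3 using 1
      simp only [map_mul, Algebra.linearMap_apply]
      ring
    · intro y hy
      rw [Submodule.mem_div_iff_forall_mul_mem] at *
      exact fun z hz => hle1 M (hy z hz)
  · apply le_antisymm
    · intro z hz
      rw [Submodule.mem_div_iff_forall_mul_mem] at hz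
      have hz1 := hz 1 (by
        rw [Submodule.mem_div_iff_forall_mul_mem]
        intro y hy
        rw [one_mul]; exact hle1 M hy)
      rw [mul_one] at hz1
      obtain ⟨r, rfl⟩ := Submodule.mem_one.1 hz1
      rw [sdm_mem_iff]
      apply hprime
      apply hIM
      rw [← sdm_mem_iff, ← show _ = _ from hd, Submodule.mem_div_iff_forall_mul_mem]
      intro w hw
      rw [Submodule.mem_div_iff_forall_mul_mem] at hw
      have := hz (algebraMap R (FractionRing R) a * w) (by
        rw [Submodule.mem_div_iff_forall_mul_mem]
        rintro _ ⟨m, hm, rfl⟩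
        have := hw _ ((sdm_mem_iff I _).2 (haI m hm))
        convert this using 1
        simp only [map_mul, Algebra.linearMap_apply]
        ring)
      convert this using 1
      rw [map_mul]; ring
    · intro z hz
      rw [Submodule.mem_div_iff_forall_mul_mem]
      intro w hw
      rw [Submodule.mem_div_iff_forall_mul_mem] at hw
      rw [mul_comm]
      exact hw z hz
end
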